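/- Let R be a commutative integral domain whose lattice of ideals contains no subset order-isomorphic to the power set of omega. Suppose that for every uncountable family A of ideals of R whose intersection is zero there is a countable subfamily of A with zero intersection. Then L_R is uniformly transversally bounded: for every family (X_i)_{i in I} of nonempty sets of ideals of R such that for each cofinite subset J of I the intersection of the ideals in the union of the X_i over i in J is zero, there exists a transversal (A_i) in Prod_{i in I} X_i whose intersection over i in I is zero. -/

import Mathlib

universe u v w

/-- Dependent choice along the finite sets of earlier values. -/
theorem exists_seq_of_forall_finset {α : Type*} (Q : ℕ → Finset α → α → Prop)
    (h : ∀ n s, ∃ y, Q n s y) :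
    ∃ (f : ℕ → α) (s : ℕ → Finset α), (∀ n, Q n (s n) (f n)) ∧ ∀ m n, m < n → f m ∈ s n := by
  classical
  choose c hc using h
  let s : ℕ → Finset α := fun n => Nat.rec ∅ (fun n t => insert (c n t) t) n
  have hs : ∀ n, s (n + 1) = insert (c n (s n)) (s n) := fun _ => rfl
  refine ⟨fun n => c n (s n), s, fun n => hc _ _, fun m n hmn => ?_⟩
  induction n, hmn using Nat.le_induction with
  | base => rw [hs]; exact Finset.mem_insert_self _ _
  | succ n _ ih => rw [hs]; exact Finset.mem_insert_of_mem ih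

/-- A sequence of ideals none of which contains the intersection of the others yields a copy of
the power set of `ℕ` in the ideal lattice. -/
theorem exists_powerset_embedding_of_irredundant {R : Type*} [CommRing R] (B : ℕ → Ideal R)
    (hB : ∀ j, ¬ (⨅ i, ⨅ (_ : i ≠ j), B i) ≤ B j) :
    ∃ f : Set ℕ → Ideal R, Function.Injective f ∧ ∀ A B : Set ℕ, A ⊆ B ↔ f A ≤ f B := by
  have key : ∀ S T : Set ℕ, S ⊆ T ↔
      (⨅ i, ⨅ (_ : i ∉ S), B i) ≤ ⨅ i, ⨅ (_ : i ∉ T), B i := by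
    refine fun S T => ⟨fun hST => ?_, fun hle n hn => ?_⟩
    · exact le_iInf₂ fun i hi => iInf₂_le i fun h => hi (hST h)
    · by_contra hnT
      refine hB n (le_trans (le_iInf₂ fun i hi => ?_) (hle.trans (iInf₂_le n hnT)))
      exact iInf₂_le i fun h : i = n => hi (h ▸ hn)
  refine ⟨fun S => ⨅ i, ⨅ (_ : i ∉ S), B i, fun S T hST => ?_, key⟩
  exact Set.Subset.antisymm ((key S T).2 hST.le) ((key T S).2 hST.ge)

section Transversal

variable {R : Type*} [CommRing R] {α I : Type*} (col : α → I) (b : α → Ideal R)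

/-- Every infinite partial transversal has an infinite subset whose intersection, cut down to `a`,
is not contained in `k`. -/
def TransversallyAvoids (a k : Ideal R) : Prop :=
  ∀ T : Set α, T.Infinite → Set.InjOn col T →
    ∃ T' ⊆ T, T'.Infinite ∧ ¬ a ⊓ (⨅ p ∈ T', b p) ≤ k

variable {col b}

theorem TransversallyAvoids.mono {a a' k : Ideal R} (h : TransversallyAvoids col b a k)
    (ha : a ≤ a') : TransversallyAvoids col b a' k := fun T hT hinj =>
  let ⟨T', hT', hinf, hk⟩ := h T hT hinj
  ⟨T', hT', hinf, fun hle => hk ((inf_le_inf_right _ ha).trans hle)⟩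

/-- If no member of a sequence of ideals with zero intersection is transversally avoided, then
some partial transversal has zero intersection. -/
theorem exists_transversal_of_not_avoids [IsDomain R] {a : Ideal R} (ha : a ≠ ⊥)
    (k : ℕ → Ideal R) (hk : ⨅ m, k m = ⊥) (hbad : ∀ m, ¬ TransversallyAvoids col b a (k m)) :
    ∃ h : ℕ → α, Function.Injective (col ∘ h) ∧ ⨅ n, b (h n) = ⊥ := by
  classical
  simp only [TransversallyAvoids] at hbad
  push Not at hbad
  choose T hT hinj hle using hbad
  obtain ⟨h, s, hQ, hs⟩ := exists_seq_of_forall_finset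
    (fun n s y => y ∈ T (Nat.unpair n).1 ∧ col y ∉ s.image col) fun n s => by
      obtain ⟨i, ⟨y, hy, rfl⟩, hi⟩ :=
        ((hT (Nat.unpair n).1).image (hinj _)).exists_notMem_finset (s.image col)
      exact ⟨y, hy, hi⟩
  have hlt : ∀ m n, m < n → col (h m) ≠ col (h n) := fun m n hmn he =>
    (hQ n).2 (he ▸ Finset.mem_image_of_mem col (hs m n hmn))
  have hcol : Function.Injective (col ∘ h) := fun m n he => by
    by_contra hne
    rcases lt_or_gt_of_ne hne with hl | hl
    · exact hlt _ _ hl he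
    · exact hlt _ _ hl he.symm
  refine ⟨h, hcol, ?_⟩
  have hbot : a ⊓ ⨅ n, b (h n) = ⊥ := by
    rw [eq_bot_iff, ← hk]
    refine le_iInf fun m => ?_
    have hsub : Set.range (fun j => h (Nat.pair m j)) ⊆ T m := by
      rintro _ ⟨j, rfl⟩
      simpa using (hQ (Nat.pair m j)).1
    have hinf : (Set.range fun j => h (Nat.pair m j)).Infinite := by
      refine Set.infinite_range_of_injective fun i j hij => ?_
      simpa using hcol.of_comp hij
    refine le_trans (inf_le_inf_left _ ?_) (hle m _ hsub hinf)
    refine le_iInf₂ ?_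
    rintro _ ⟨j, rfl⟩
    exact iInf_le _ _
  exact (Ideal.mul_eq_bot.1 (eq_bot_iff.2 (Ideal.mul_le_inf.trans hbot.le))).resolve_left ha

/-- A partial transversal each of whose members is transversally avoided by the intersection of
its predecessors has an irredundant subsequence. -/
theorem exists_irredundant_of_avoids (p : ℕ → α) (hp : Function.Injective (col ∘ p))
    (hgood : ∀ n, TransversallyAvoids col b (⨅ m, ⨅ (_ : m < n), b (p m)) (b (p n))) :
    ∃ B : ℕ → Ideal R, ∀ j, ¬ (⨅ i, ⨅ (_ : i ≠ j), B i) ≤ B j := by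
  have step : ∀ N : {N : Set ℕ // N.Infinite}, ∃ n ∈ N.1, ∃ N' : {N : Set ℕ // N.Infinite},
      N'.1 ⊆ N.1 ∧ (∀ m ∈ N'.1, n < m) ∧
      ¬ (⨅ m, ⨅ (_ : m < n), b (p m)) ⊓ (⨅ m ∈ N'.1, b (p m)) ≤ b (p n) := by
    rintro ⟨N, hN⟩
    obtain ⟨n, hn⟩ := hN.nonempty
    have hM : (N ∩ Set.Ioi n).Infinite := by
      refine (hN.sdiff (Set.finite_Iic n)).mono fun m hm => ⟨hm.1, ?_⟩
      simpa using hm.2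
    obtain ⟨T', hsub, hinf, hnot⟩ := hgood n (p '' (N ∩ Set.Ioi n))
      (hM.image hp.of_comp.injOn) (hp.injOn.image_of_comp)
    refine ⟨n, hn, ⟨N ∩ Set.Ioi n ∩ p ⁻¹' T', ?_⟩, fun m hm => hm.1.1, fun m hm => hm.1.2, ?_⟩
    · refine Set.Infinite.of_image p (hinf.mono fun t ht => ?_)
      obtain ⟨m, hm, rfl⟩ := hsub ht
      exact ⟨m, ⟨hm, ht⟩, rfl⟩
    · refine fun hle => hnot (le_trans (inf_le_inf_left _ ?_) hle)
      exact le_iInf₂ fun m hm => iInf₂_le (p m) hm.2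
  choose n hn next hsub hgt hnot using step
  obtain ⟨N, hN⟩ : ∃ N : ℕ → {N : Set ℕ // N.Infinite}, ∀ j, N (j + 1) = next (N j) :=
    ⟨fun j => Nat.rec ⟨Set.univ, Set.infinite_univ⟩ (fun _ M => next M) j, fun _ => rfl⟩
  have hanti : Antitone fun j => (N j).1 := antitone_nat_of_succ_le fun j => by
    rw [hN]; exact hsub (N j)
  have hmem : ∀ i j, i < j → n (N j) ∈ (next (N i)).1 := fun i j hij => by
    rw [← hN]; exact hanti (Nat.succ_le_of_lt hij) (hn (N j))
  refine ⟨fun j => b (p (n (N j))), fun j hle => hnot (N j) (le_trans ?_ hle)⟩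
  refine le_iInf₂ fun i hi => ?_
  rcases lt_or_gt_of_ne hi with hl | hl
  · exact inf_le_left.trans
      (iInf_le_of_le (n (N i)) (iInf_le_of_le (hgt _ _ (hmem i j hl)) le_rfl))
  · exact inf_le_right.trans
      (iInf_le_of_le (n (N i)) (iInf_le_of_le (hmem j i hl) le_rfl))

end Transversal

/-- Let `R` be a commutative integral domain whose lattice of ideals contains no subset
order-isomorphic to the power set of `ℕ`, and suppose that every uncountable family of
ideals of `R` with zero intersection admits a countable subfamily with zero intersection.
Then `L_R` is uniformly transversally bounded: for every family `(X i)_{i : I}` of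
nonempty sets of ideals of `R` such that for each cofinite subset `J` of `I` the
intersection of the ideals in `⋃ i ∈ J, X i` is zero, there is a transversal
`(A i) ∈ Π i, X i` whose intersection is zero. -/
theorem utb_of_countable_interpolation (R : Type u) [CommRing R] [IsDomain R]
    (hR : ¬ ∃ f : Set ℕ → Ideal R, Function.Injective f ∧
      ∀ A B : Set ℕ, A ⊆ B ↔ f A ≤ f B)
    (hcc : ∀ A : Set (Ideal R), ¬ A.Countable → sInf A = ⊥ →
      ∃ A' ⊆ A, A'.Countable ∧ sInf A' = ⊥)
    (I : Type v) (X : I → Set (Ideal R)) (hX : ∀ i, (X i).Nonempty)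
    (hJ : ∀ J : Set I, Jᶜ.Finite → sInf (⋃ i ∈ J, X i) = ⊥) :
    ∃ A : I → Ideal R, (∀ i, A i ∈ X i) ∧ (⨅ i, A i) = ⊥ := by
  classical
  by_cases hz : ∃ i, ⊥ ∈ X i
  · obtain ⟨i, hi⟩ := hz
    choose A hA using hX
    refine ⟨Function.update A i ⊥, fun j => ?_, ?_⟩
    · rcases eq_or_ne j i with rfl | hj
      · simpa using hi
      · simpa [hj] using hA j
    · exact eq_bot_iff.2 ((iInf_le _ i).trans (by simp))
  let α := {p : I × Ideal R // p.2 ∈ X p.1}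
  let col : α → I := fun p => p.1.1
  let b : α → Ideal R := fun p => p.1.2
  have hb : ∀ p, b p ≠ ⊥ := fun p hp => hz ⟨col p, hp ▸ p.2⟩
  suffices hpart : ∃ h : ℕ → α, Function.Injective (col ∘ h) ∧ ⨅ n, b (h n) = ⊥ by
    obtain ⟨h, hinj, hbot⟩ := hpart
    have hext : ∀ i, ∃ A ∈ X i, ∀ n, col (h n) = i → A = b (h n) := fun i => by
      by_cases hi : ∃ n, col (h n) = i
      · obtain ⟨n, rfl⟩ := hi
        exact ⟨b (h n), (h n).2, fun m hm => by rw [hinj hm]⟩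
      · exact ⟨_, (hX i).some_mem, fun n hn => (hi ⟨n, hn⟩).elim⟩
    choose A hA hAeq using hext
    refine ⟨A, hA, eq_bot_iff.2 (hbot ▸ le_iInf fun n => ?_)⟩
    exact (iInf_le A (col (h n))).trans (hAeq _ n rfl).le
  by_contra hno
  have hne : ∀ s : Finset α, s.inf b ≠ ⊥ := fun s => by
    induction s using Finset.induction_on with
    | empty => simp
    | insert p s _ ih =>
      rw [Finset.inf_insert]
      intro h0
      rcases Ideal.mul_eq_bot.1 (eq_bot_iff.2 (Ideal.mul_le_inf.trans h0.le)) with h | h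
      exacts [hb p h, ih h]
  have hstep : ∀ s : Finset α, ∃ y : α,
      col y ∉ s.image col ∧ TransversallyAvoids col b (s.inf b) (b y) := fun s => by
    by_contra! hbad
    have h0 := hJ {i | i ∉ s.image col} (by
      convert (s.image col).finite_toSet using 1
      ext i; simp)
    obtain ⟨S, hS, hSc, hS0⟩ : ∃ S ⊆ ⋃ i ∈ {i | i ∉ s.image col}, X i,
        S.Countable ∧ sInf S = ⊥ := by
      by_cases hc : (⋃ i ∈ {i | i ∉ s.image col}, X i).Countable
      · exact ⟨_, subset_rfl, hc, h0⟩
      · exact hcc _ hc h0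
    have hSne : S.Nonempty := by
      rw [Set.nonempty_iff_ne_empty]
      rintro rfl
      simp at hS0
    obtain ⟨k, rfl⟩ := hSc.exists_eq_range hSne
    refine hno (exists_transversal_of_not_avoids (hne s) k hS0 fun m => ?_)
    obtain ⟨i, hi, hm⟩ := Set.mem_iUnion₂.1 (hS ⟨m, rfl⟩)
    exact hbad ⟨(i, k m), hm⟩ hi
  obtain ⟨p, s, hQ, hs⟩ := exists_seq_of_forall_finset
    (fun _ s y => col y ∉ s.image col ∧ TransversallyAvoids col b (s.inf b) (b y))
    fun _ => hstep
  have hlt : ∀ m n, m < n → col (p m) ≠ col (p n) := fun m n hmn he =>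
    (hQ n).1 (he ▸ Finset.mem_image_of_mem col (hs m n hmn))
  have hp : Function.Injective (col ∘ p) := fun m n he => by
    by_contra hmn
    rcases lt_or_gt_of_ne hmn with hl | hl
    · exact hlt _ _ hl he
    · exact hlt _ _ hl he.symm
  obtain ⟨B, hB⟩ := exists_irredundant_of_avoids p hp fun n =>
    (hQ n).2.mono (le_iInf₂ fun m hm => Finset.inf_le (hs m n hm))
  exact hR (exists_powerset_embedding_of_irredundant B hB)
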